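/- Let A be an m×m diagonal matrix with positive diagonal entries. Every bounded entire C² solution u : ℝⁿ → ℝ^m of the anisotropic Ginzburg–Landau system A Δu = (|u|² − 1)u satisfies |u(x)| ≤ 1 for all x ∈ ℝⁿ, and |u(x)| < 1 for all x if u is not constant. -/

import Mathlib

/-- Componentwise Laplacian of a map `ℝⁿ → ℝᵐ`. -/
noncomputable def vectorLaplacian {n m : ℕ}
    (u : EuclideanSpace ℝ (Fin n) → EuclideanSpace ℝ (Fin m))
    (x : EuclideanSpace ℝ (Fin n)) : EuclideanSpace ℝ (Fin m) :=
  ∑ i : Fin n, fderiv ℝ (fun y => fderiv ℝ u y (EuclideanSpace.single i 1)) x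
    (EuclideanSpace.single i 1)

open Filter Topology

theorem agl_second_deriv_nonneg {f f' : ℝ → ℝ} {d : ℝ} (hf : ∀ t, HasDerivAt f (f' t) t)
    (hf' : HasDerivAt f' d 0) (hmin : IsLocalMin f 0) : 0 ≤ d := by
  by_contra hd
  push Not at hd
  have e1 : deriv f = f' := funext fun t => (hf t).deriv
  have hmax : IsLocalMax f 0 := by
    apply isLocalMax_of_deriv_deriv_neg
    · rw [e1, hf'.deriv]; exact hd
    · exact hmin.deriv_eq_zero
    · exact (hf 0).continuousAt
  have hc : f =ᶠ[𝓝 0] fun _ => f 0 := by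
    filter_upwards [hmin, hmax] with t h1 h2
    exact le_antisymm h2 h1
  have hc' : f' =ᶠ[𝓝 0] fun _ => 0 := by
    rw [← e1]
    have := hc.deriv
    simpa using this
  have : d = 0 := by
    rw [← hf'.deriv, hc'.deriv_eq]; simp
  linarith

/-- second-order line data for a scalar function -/
def AglLine {n : ℕ} (F : EuclideanSpace ℝ (Fin n) → ℝ) (x e : EuclideanSpace ℝ (Fin n))
    (d : ℝ) : Prop :=
  ∃ f' : ℝ → ℝ, (∀ t, HasDerivAt (fun t : ℝ => F (x + t • e)) (f' t) t) ∧ HasDerivAt f' d 0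

theorem AglLine.nonneg {n : ℕ} {F : EuclideanSpace ℝ (Fin n) → ℝ}
    {x e : EuclideanSpace ℝ (Fin n)} {d : ℝ} (h : AglLine F x e d) (hmin : IsLocalMin F x) :
    0 ≤ d := by
  obtain ⟨f', h1, h2⟩ := h
  refine agl_second_deriv_nonneg h1 h2 ?_
  have hc : ContinuousAt (fun t : ℝ => x + t • e) 0 := by fun_prop
  have hm : IsLocalMin F ((fun t : ℝ => x + t • e) 0) := by simpa using hmin
  exact hc.eventually hm

theorem AglLine.sum_nonneg {n : ℕ} {F : EuclideanSpace ℝ (Fin n) → ℝ}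
    {x : EuclideanSpace ℝ (Fin n)} {d : Fin n → ℝ}
    (h : ∀ i, AglLine F x (EuclideanSpace.single i 1) (d i)) (hmin : IsLocalMin F x) :
    0 ≤ ∑ i, d i :=
  Finset.sum_nonneg fun i _ => (h i).nonneg hmin

theorem agl_single_norm {n : ℕ} (i : Fin n) :
    ‖(EuclideanSpace.single i 1 : EuclideanSpace ℝ (Fin n))‖ = 1 := by simp

theorem AglLine.add {n : ℕ} {F G : EuclideanSpace ℝ (Fin n) → ℝ}
    {x e : EuclideanSpace ℝ (Fin n)} {d d' : ℝ} (h : AglLine F x e d) (h' : AglLine G x e d') :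
    AglLine (fun y => F y + G y) x e (d + d') := by
  obtain ⟨f', h1, h2⟩ := h
  obtain ⟨g', h3, h4⟩ := h'
  exact ⟨fun t => f' t + g' t, fun t => (h1 t).add (h3 t), h2.add h4⟩

theorem AglLine.const_mul {n : ℕ} {F : EuclideanSpace ℝ (Fin n) → ℝ}
    {x e : EuclideanSpace ℝ (Fin n)} {d : ℝ} (h : AglLine F x e d) (c : ℝ) :
    AglLine (fun y => c * F y) x e (c * d) := by
  obtain ⟨f', h1, h2⟩ := h
  exact ⟨fun t => c * f' t, fun t => (h1 t).const_mul c, h2.const_mul c⟩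

theorem agl_hasDerivAt_line {n : ℕ} (x e : EuclideanSpace ℝ (Fin n)) (t : ℝ) :
    HasDerivAt (fun t : ℝ => x + t • e) e t := by
  simpa using ((hasDerivAt_id t).smul_const e).const_add x

theorem agl_line_exp {n : ℕ} (x e y : EuclideanSpace ℝ (Fin n)) (he : ‖e‖ = 1) (α : ℝ) :
    AglLine (fun z => Real.exp (-α * ‖z - y‖ ^ 2)) x e
      ((4 * α ^ 2 * (inner ℝ (x - y) e) ^ 2 - 2 * α) * Real.exp (-α * ‖x - y‖ ^ 2)) := by
  have hl : ∀ t, HasDerivAt (fun t : ℝ => x + t • e - y) e t :=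
    fun t => (agl_hasDerivAt_line x e t).sub_const y
  have hs : ∀ t, HasDerivAt (fun t : ℝ => ‖x + t • e - y‖ ^ 2)
      (2 * inner ℝ (x + t • e - y) e) t := fun t => (hl t).norm_sq
  have hs' : HasDerivAt (fun t : ℝ => 2 * inner ℝ (x + t • e - y) e) 2 0 := by
    have := ((hl 0).inner ℝ (hasDerivAt_const (0:ℝ) e)).const_mul 2
    simpa [he] using this
  have hg : ∀ t, HasDerivAt (fun t : ℝ => Real.exp (-α * ‖x + t • e - y‖ ^ 2))
      (Real.exp (-α * ‖x + t • e - y‖ ^ 2) * (-α * (2 * inner ℝ (x + t • e - y) e))) t :=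
    fun t => ((hs t).const_mul (-α)).exp
  refine ⟨_, hg, ?_⟩
  have := (hg 0).mul (hs'.const_mul (-α))
  refine this.congr_deriv ?_
  simp only [zero_smul, add_zero]
  ring

theorem agl_line_sq {n : ℕ} (x e : EuclideanSpace ℝ (Fin n)) (he : ‖e‖ = 1) :
    AglLine (fun z => ‖z‖ ^ 2) x e 2 := by
  have hl := agl_hasDerivAt_line x e
  refine ⟨_, fun t => (hl t).norm_sq, ?_⟩
  have := ((hl 0).inner ℝ (hasDerivAt_const (0:ℝ) e)).const_mul 2
  simpa [he] using this

theorem agl_line_u {n m : ℕ} (u : EuclideanSpace ℝ (Fin n) → EuclideanSpace ℝ (Fin m))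
    (hu : ContDiff ℝ 2 u) (x e : EuclideanSpace ℝ (Fin n)) :
    AglLine (fun z => ‖u z‖ ^ 2) x e
      (2 * (‖fderiv ℝ u x e‖ ^ 2 +
        inner ℝ (u x) (fderiv ℝ (fun y => fderiv ℝ u y e) x e))) := by
  have hl := agl_hasDerivAt_line x e
  have hd : Differentiable ℝ u := hu.differentiable (by norm_num)
  have hd2 : Differentiable ℝ (fun y => fderiv ℝ u y e) := by
    have h1 : ContDiff ℝ 1 (fderiv ℝ u) := hu.fderiv_right (by norm_num)
    exact (h1.differentiable (by norm_num)).clm_apply (differentiable_const e)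
  have h1 : ∀ t, HasDerivAt (fun t : ℝ => u (x + t • e)) (fderiv ℝ u (x + t • e) e) t :=
    fun t => (hd (x + t • e)).hasFDerivAt.comp_hasDerivAt t (hl t)
  have h2 : HasDerivAt (fun t : ℝ => fderiv ℝ u (x + t • e) e)
      (fderiv ℝ (fun y => fderiv ℝ u y e) (x + (0:ℝ) • e) e) 0 :=
    HasFDerivAt.comp_hasDerivAt (l := fun y => fderiv ℝ u y e) (0:ℝ)
      (hd2 (x + (0:ℝ) • e)).hasFDerivAt (hl 0)
  refine ⟨_, fun t => (h1 t).norm_sq, ?_⟩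
  have := ((h1 0).inner ℝ h2).const_mul 2
  refine this.congr_deriv ?_
  simp only [zero_smul, add_zero, real_inner_self_eq_norm_sq]
  ring

theorem agl_sum {n m : ℕ} (a : Fin m → ℝ) (ha : ∀ i, 0 < a i)
    (u : EuclideanSpace ℝ (Fin n) → EuclideanSpace ℝ (Fin m))
    (hsol : ∀ x, ∀ i : Fin m, a i * vectorLaplacian u x i = (‖u x‖ ^ 2 - 1) * u x i)
    (x : EuclideanSpace ℝ (Fin n)) :
    ∑ i : Fin n, inner ℝ (u x) (fderiv ℝ (fun y => fderiv ℝ u y (EuclideanSpace.single i 1)) x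
      (EuclideanSpace.single i 1)) = (‖u x‖ ^ 2 - 1) * ∑ j, (u x j) ^ 2 / a j := by
  rw [← inner_sum]
  change inner ℝ (u x) (vectorLaplacian u x) = _
  rw [PiLp.inner_apply, Finset.mul_sum]
  refine Finset.sum_congr rfl fun j _ => ?_
  have h := hsol x j
  have hj := ha j
  have h2 : vectorLaplacian u x j = (‖u x‖ ^ 2 - 1) * u x j / a j := by
    field_simp; linarith
  rw [h2]
  simp
  ring

theorem agl_bounds {n m : ℕ} (a : Fin m → ℝ) (ha : ∀ i, 0 < a i)
    (u : EuclideanSpace ℝ (Fin n) → EuclideanSpace ℝ (Fin m)) :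
    ∃ c Q : ℝ, 0 < c ∧ 0 ≤ Q ∧ ∀ x, c * ‖u x‖ ^ 2 ≤ ∑ j, (u x j) ^ 2 / a j ∧
      ∑ j, (u x j) ^ 2 / a j ≤ Q * ‖u x‖ ^ 2 := by
  have hS : 0 ≤ ∑ j, a j := Finset.sum_nonneg fun j _ => (ha j).le
  refine ⟨1 / (1 + ∑ j, a j), ∑ j, 1 / a j, by positivity,
    Finset.sum_nonneg fun j _ => (one_div_pos.2 (ha j)).le, fun x => ?_⟩
  rw [EuclideanSpace.real_norm_sq_eq, Finset.mul_sum, Finset.mul_sum]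
  constructor
  · refine Finset.sum_le_sum fun j _ => ?_
    have h1 : a j ≤ 1 + ∑ j, a j := by
      have := Finset.single_le_sum (f := a) (fun j _ => (ha j).le) (Finset.mem_univ j)
      linarith
    have h2 := one_div_le_one_div_of_le (ha j) h1
    rw [div_eq_mul_one_div (u x j ^ 2), mul_comm (u x j ^ 2)]
    gcongr
  · refine Finset.sum_le_sum fun j _ => ?_
    have h2 : 1 / a j ≤ ∑ j, 1 / a j := Finset.single_le_sum (f := fun j => 1 / a j)
      (fun j _ => (one_div_pos.2 (ha j)).le) (Finset.mem_univ j)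
    rw [div_eq_mul_one_div (u x j ^ 2), mul_comm (u x j ^ 2)]
    gcongr

theorem agl_part1 {n m : ℕ}
    (a : Fin m → ℝ) (ha : ∀ i, 0 < a i)
    (u : EuclideanSpace ℝ (Fin n) → EuclideanSpace ℝ (Fin m))
    (hu : ContDiff ℝ 2 u) (hbdd : ∃ C : ℝ, ∀ x, ‖u x‖ ≤ C)
    (hsol : ∀ x, ∀ i : Fin m, a i * vectorLaplacian u x i = (‖u x‖ ^ 2 - 1) * u x i)
    (x₀ : EuclideanSpace ℝ (Fin n)) : ‖u x₀‖ ^ 2 ≤ 1 := by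
  by_contra hx₀
  push Not at hx₀
  obtain ⟨c, Q, hc, hQ, hq⟩ := agl_bounds a ha u
  obtain ⟨C, hC⟩ := hbdd
  obtain ⟨δ, hδ, hδ2⟩ : ∃ δ : ℝ, 0 < δ ∧ ‖u x₀‖ ^ 2 = 1 + 2 * δ :=
    ⟨(‖u x₀‖ ^ 2 - 1) / 2, by linarith, by ring⟩
  obtain ⟨ε, hε, hε1, hε2⟩ : ∃ ε : ℝ, 0 < ε ∧ ε * ‖x₀‖ ^ 2 ≤ δ ∧ n * ε < δ * c := by
    refine ⟨min (δ / (‖x₀‖ ^ 2 + 1)) (δ * c / (n + 1)), by positivity, ?_, ?_⟩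
    · calc _ ≤ δ / (‖x₀‖ ^ 2 + 1) * ‖x₀‖ ^ 2 := by gcongr; exact min_le_left _ _
        _ ≤ δ / (‖x₀‖ ^ 2 + 1) * (‖x₀‖ ^ 2 + 1) := by gcongr; linarith
        _ = δ := by field_simp
    · calc _ ≤ n * (δ * c / (n + 1)) := by gcongr; exact min_le_right _ _
        _ < (n + 1) * (δ * c / (n + 1)) := by gcongr; linarith
        _ = δ * c := by field_simp
  have hcont : Continuous fun z => (-1) * ‖u z‖ ^ 2 + ε * ‖z‖ ^ 2 := by
    have := hu.continuous
    fun_prop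
  have htend : Tendsto (fun z : EuclideanSpace ℝ (Fin n) => (-1) * ‖u z‖ ^ 2 + ε * ‖z‖ ^ 2)
      (cocompact _) atTop := by
    refine tendsto_atTop_add_left_of_le _ (-C ^ 2) (fun z => ?_) ?_
    · have : ‖u z‖ ^ 2 ≤ C ^ 2 := by gcongr; exact hC z
      linarith
    · exact ((tendsto_pow_atTop two_ne_zero).comp
        (tendsto_norm_cocompact_atTop (E := EuclideanSpace ℝ (Fin n)))).const_mul_atTop hε
  obtain ⟨x, hx⟩ := hcont.exists_forall_le htend
  have hmin : IsLocalMin (fun z => (-1) * ‖u z‖ ^ 2 + ε * ‖z‖ ^ 2) x :=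
    Eventually.of_forall hx
  have hsum := AglLine.sum_nonneg (fun i =>
    ((agl_line_u u hu x (EuclideanSpace.single i 1)).const_mul (-1)).add
    ((agl_line_sq x (EuclideanSpace.single i 1) (agl_single_norm i)).const_mul ε)) hmin
  rw [Finset.sum_add_distrib, ← Finset.mul_sum, ← Finset.mul_sum, Finset.sum_add_distrib,
    agl_sum a ha u hsol x] at hsum
  have hP : 0 ≤ ∑ i : Fin n, ‖fderiv ℝ u x (EuclideanSpace.single i 1)‖ ^ 2 :=
    Finset.sum_nonneg fun _ _ => sq_nonneg _
  simp only [Finset.sum_const, Finset.card_univ, Fintype.card_fin, nsmul_eq_mul] at hsum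
  have h0 := hx x₀
  have hn : 0 ≤ ε * ‖x‖ ^ 2 := by positivity
  have hw : 1 + δ ≤ ‖u x‖ ^ 2 := by linarith
  have hqc : c ≤ ∑ j, (u x j) ^ 2 / a j := by
    refine le_trans ?_ (hq x).1
    nlinarith
  have : δ * c ≤ (‖u x‖ ^ 2 - 1) * ∑ j, (u x j) ^ 2 / a j := by
    exact mul_le_mul (by linarith) hqc hc.le (by linarith)
  nlinarith

theorem agl_part2 {n m : ℕ}
    (a : Fin m → ℝ) (ha : ∀ i, 0 < a i)
    (u : EuclideanSpace ℝ (Fin n) → EuclideanSpace ℝ (Fin m))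
    (hu : ContDiff ℝ 2 u)
    (hsol : ∀ x, ∀ i : Fin m, a i * vectorLaplacian u x i = (‖u x‖ ^ 2 - 1) * u x i)
    (hle : ∀ x, ‖u x‖ ^ 2 ≤ 1)
    (x₀ y : EuclideanSpace ℝ (Fin n)) (hy : ‖u y‖ ^ 2 < 1) : ‖u x₀‖ ^ 2 < 1 := by
  obtain ⟨c, Q, hc, hQ, hq⟩ := agl_bounds a ha u
  have huc := hu.continuous
  obtain ⟨M, hM, hM2⟩ : ∃ M : ℝ, 0 < M ∧ ‖u y‖ ^ 2 < 1 - M :=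
    ⟨(1 - ‖u y‖ ^ 2) / 2, by linarith, by linarith⟩
  have hev : ∀ᶠ z in 𝓝 y, ‖u z‖ ^ 2 < 1 - M :=
    (by fun_prop : ContinuousAt (fun z => ‖u z‖ ^ 2) y).eventually_lt continuousAt_const hM2
  obtain ⟨r, hr, hball⟩ := Metric.eventually_nhds_iff.1 hev
  obtain ⟨α, hα, hαr⟩ : ∃ α : ℝ, 1 ≤ α ∧ n + Q + 1 ≤ α * r ^ 2 := by
    refine ⟨(n + Q + 1) / r ^ 2 + 1, ?_, ?_⟩
    · have : 0 ≤ (n + Q + 1) / r ^ 2 := by positivity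
      linarith
    · rw [add_mul, div_mul_cancel₀ _ (by positivity)]
      nlinarith
  set R := ‖x₀ - y‖ + 1 with hR
  have hcont : Continuous fun z =>
      (-1) * ‖u z‖ ^ 2 + (-M) * Real.exp (-α * ‖z - y‖ ^ 2) := by fun_prop
  obtain ⟨x, hxB, hx⟩ := (isCompact_closedBall y R).exists_isMinOn
    ⟨x₀, by rw [mem_closedBall_iff_norm]; linarith⟩ hcont.continuousOn
  have hx0 := hx (show x₀ ∈ Metric.closedBall y R by rw [mem_closedBall_iff_norm]; linarith)
  simp only [Set.mem_ofPred_eq] at hx0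
  have hlt : Real.exp (-α * R ^ 2) < Real.exp (-α * ‖x₀ - y‖ ^ 2) := by
    apply Real.exp_lt_exp.2
    have := norm_nonneg (x₀ - y)
    rw [hR]; nlinarith
  -- it suffices to bound the minimum from below
  by_contra hcon
  have hx01 : ‖u x₀‖ ^ 2 = 1 := le_antisymm (hle x₀) (not_lt.1 hcon)
  have hneg : 1 - ‖u x‖ ^ 2 <
      M * Real.exp (-α * ‖x - y‖ ^ 2) - M * Real.exp (-α * R ^ 2) := by nlinarith
  have hg1 : Real.exp (-α * ‖x - y‖ ^ 2) ≤ 1 := by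
    apply Real.exp_le_one_iff.2
    have := sq_nonneg ‖x - y‖
    nlinarith
  have hgR : 0 < Real.exp (-α * R ^ 2) := Real.exp_pos _
  have hg : 0 < Real.exp (-α * ‖x - y‖ ^ 2) := Real.exp_pos _
  have hrx : r ≤ ‖x - y‖ := by
    by_contra h
    have := hball (y := x) (by rw [dist_eq_norm]; linarith)
    nlinarith
  have hxR : ‖x - y‖ < R := by
    refine lt_of_le_of_ne (mem_closedBall_iff_norm.1 hxB) fun h => ?_
    rw [h] at hneg
    have := hle x
    linarith
  have hmin : IsLocalMin (fun z => (-1) * ‖u z‖ ^ 2 + (-M) * Real.exp (-α * ‖z - y‖ ^ 2)) x :=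
    hx.isLocalMin (Metric.closedBall_mem_nhds_of_mem (mem_ball_iff_norm.2 hxR))
  have hsum := AglLine.sum_nonneg (fun i =>
    ((agl_line_u u hu x (EuclideanSpace.single i 1)).const_mul (-1)).add
    ((agl_line_exp x (EuclideanSpace.single i 1) y (agl_single_norm i) α).const_mul (-M))) hmin
  rw [Finset.sum_add_distrib, ← Finset.mul_sum, ← Finset.mul_sum, ← Finset.mul_sum,
    Finset.sum_add_distrib, agl_sum a ha u hsol x, ← Finset.sum_mul, Finset.sum_sub_distrib,
    ← Finset.mul_sum] at hsum
  have hinner : ∑ i : Fin n, (inner ℝ (x - y) (EuclideanSpace.single i (1:ℝ))) ^ 2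
      = ‖x - y‖ ^ 2 := by
    rw [EuclideanSpace.real_norm_sq_eq]
    simp [EuclideanSpace.inner_single_right]
  rw [hinner] at hsum
  have hP : 0 ≤ ∑ i : Fin n, ‖fderiv ℝ u x (EuclideanSpace.single i 1)‖ ^ 2 :=
    Finset.sum_nonneg fun _ _ => sq_nonneg _
  simp only [Finset.sum_const, Finset.card_univ, Fintype.card_fin, nsmul_eq_mul] at hsum
  set q := ∑ j, (u x j) ^ 2 / a j
  set g := Real.exp (-α * ‖x - y‖ ^ 2)
  have hq0 : 0 ≤ q := le_trans (by positivity) (hq x).1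
  have hq1 : q ≤ Q := (hq x).2.trans (by nlinarith [hle x])
  have hv : (1 - ‖u x‖ ^ 2) * q ≤ (M * g) * Q := by
    have : 1 - ‖u x‖ ^ 2 ≤ M * g := by nlinarith
    have h3 : 0 ≤ M * g := by positivity
    exact mul_le_mul this hq1 hq0 h3
  have hMg : 0 < M * g := by positivity
  have hkey : 0 < 4 * α ^ 2 * ‖x - y‖ ^ 2 - n * (2 * α) - 2 * Q := by
    have h1 : r ^ 2 ≤ ‖x - y‖ ^ 2 := by gcongr
    have h2 : n + Q + 1 ≤ α * ‖x - y‖ ^ 2 := hαr.trans (by gcongr)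
    have h3 : α * (n + Q + 1) ≤ α * (α * ‖x - y‖ ^ 2) := by gcongr
    have hn : (0:ℝ) ≤ n := by positivity
    have h4 : 0 ≤ α * n := by positivity
    have h5 : Q ≤ α * Q := by nlinarith
    nlinarith
  have := mul_pos hMg hkey
  nlinarith

theorem anisotropic_ginzburg_landau_confinement {n m : ℕ}
    (a : Fin m → ℝ) (ha : ∀ i, 0 < a i)
    (u : EuclideanSpace ℝ (Fin n) → EuclideanSpace ℝ (Fin m))
    (hu : ContDiff ℝ 2 u) (hbdd : ∃ C : ℝ, ∀ x, ‖u x‖ ≤ C)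
    (hsol : ∀ x, ∀ i : Fin m, a i * vectorLaplacian u x i = (‖u x‖ ^ 2 - 1) * u x i) :
    (∀ x, ‖u x‖ ≤ 1) ∧ ((¬ ∃ c, ∀ x, u x = c) → ∀ x, ‖u x‖ < 1) := by
  have hle := agl_part1 a ha u hu hbdd hsol
  refine ⟨fun x => by nlinarith [hle x, norm_nonneg (u x)], fun hnc x₀ => ?_⟩
  by_contra hx₀
  push Not at hx₀
  have hone : ∀ y, ‖u y‖ ^ 2 = 1 := by
    intro y
    by_contra hy
    have := agl_part2 a ha u hu hsol hle x₀ y (lt_of_le_of_ne (hle y) hy)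
    nlinarith
  apply hnc
  have hf : ∀ x, fderiv ℝ u x = 0 := by
    intro x
    have hmin : IsLocalMin (fun z => (-1) * ‖u z‖ ^ 2) x :=
      Eventually.of_forall fun z => by simp [hone]
    have hsum := AglLine.sum_nonneg (fun i =>
      (agl_line_u u hu x (EuclideanSpace.single i 1)).const_mul (-1)) hmin
    rw [← Finset.mul_sum, ← Finset.mul_sum, Finset.sum_add_distrib, agl_sum a ha u hsol x,
      hone x] at hsum
    have hP : ∑ i : Fin n, ‖fderiv ℝ u x (EuclideanSpace.single i 1)‖ ^ 2 = 0 :=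
      le_antisymm (by linarith) (Finset.sum_nonneg fun _ _ => sq_nonneg _)
    rw [Finset.sum_eq_zero_iff_of_nonneg (fun _ _ => sq_nonneg _)] at hP
    ext1 v
    have hv : v = ∑ i, v i • EuclideanSpace.single i (1:ℝ) := by
      have := (EuclideanSpace.basisFun (Fin n) ℝ).sum_repr v
      simpa using this.symm
    rw [hv, map_sum]
    refine Finset.sum_eq_zero fun i hi => ?_
    have := hP i hi
    rw [map_smul, norm_eq_zero.1 (pow_eq_zero_iff two_ne_zero |>.1 this), smul_zero]
  exact ⟨u 0, fun x => is_const_of_fderiv_eq_zero (hu.differentiable (by norm_num)) hf x 0⟩
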